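/- Let p > 3 be a prime congruent to 1 modulo 3 and let r be an integer whose residue modulo p is not a cube in the field with p elements. Then the rank of appearance of p in the Pell-Z sequence of parameter r is at most p; that is, there exists a positive integer m with m ≤ p such that p divides Z_m(r). -/

import Mathlib

/-- The Pell-X sequence of parameter `r`. -/
def pellX (r : ℤ) : ℕ → ℤ
  | 0 => 1
  | 1 => 1
  | 2 => 1
  | n + 3 => 3 * pellX r (n + 2) - 3 * pellX r (n + 1) + (r + 1) * pellX r n

/-- The Pell-Y sequence of parameter `r`. -/
def pellY (r : ℤ) : ℕ → ℤ
  | 0 => 0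
  | 1 => 1
  | 2 => 2
  | n + 3 => 3 * pellY r (n + 2) - 3 * pellY r (n + 1) + (r + 1) * pellY r n

/-- The Pell-Z sequence of parameter `r`. -/
def pellZ (r : ℤ) : ℕ → ℤ
  | 0 => 0
  | 1 => 0
  | 2 => 1
  | n + 3 => 3 * pellZ r (n + 2) - 3 * pellZ r (n + 1) + (r + 1) * pellZ r n

/-- If `t ^ 3 = r`, then the Pell sequences are the coordinates of the powers of `1 + t`. -/
theorem one_add_pow_eq_pell {A : Type*} [CommRing A] (r : ℤ) (t : A) (ht : t ^ 3 = (r : A)) :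
    ∀ n : ℕ, (1 + t) ^ n = (pellX r n : A) + pellY r n * t + pellZ r n * t ^ 2
  | 0 => by simp [pellX, pellY, pellZ]
  | 1 => by simp [pellX, pellY, pellZ]
  | 2 => by simp [pellX, pellY, pellZ]; ring
  | n + 3 => by
    have h₀ := one_add_pow_eq_pell r t ht n
    have h₁ := one_add_pow_eq_pell r t ht (n + 1)
    have h₂ := one_add_pow_eq_pell r t ht (n + 2)
    have hrec : (1 + t) ^ (n + 3) =
        3 * (1 + t) ^ (n + 2) - 3 * (1 + t) ^ (n + 1) + ((r : A) + 1) * (1 + t) ^ n := by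
      rw [← ht]; ring
    rw [hrec, h₀, h₁, h₂]
    simp only [pellX, pellY, pellZ]
    push_cast
    ring

open Polynomial in
/-- A prime `p` congruent to `1` modulo `3` divides the Pell-Z number of index `p`. -/
theorem prime_dvd_pellZ (p : ℕ) (hp : p.Prime) (hpmod : p % 3 = 1) (r : ℤ) :
    (p : ℤ) ∣ pellZ r p := by
  have : Fact p.Prime := ⟨hp⟩
  let f : (ZMod p)[X] := X ^ 3 - C (r : ZMod p)
  have hf : f.Monic := monic_X_pow_sub_C _ three_ne_zero
  have : Nontrivial (AdjoinRoot f) := AdjoinRoot.nontrivial f (by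
    rw [degree_X_pow_sub_C (by norm_num)]; norm_num)
  have : CharP (AdjoinRoot f) p := charP_of_injective_algebraMap
    (algebraMap (ZMod p) (AdjoinRoot f)).injective p
  let t := AdjoinRoot.root f
  have ht : t ^ 3 = (r : AdjoinRoot f) := by
    have h : AdjoinRoot.mk f f = 0 := AdjoinRoot.mk_self
    simpa [f, t, sub_eq_zero] using h
  have hpow : (1 + t) ^ p = 1 + (r : AdjoinRoot f) ^ (p / 3) * t := by
    rw [add_pow_char, one_pow, ← ht, ← pow_mul, ← pow_succ]
    congr 2
    omega
  rw [one_add_pow_eq_pell r t ht p] at hpow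
  let g : (ZMod p)[X] := C (pellZ r p : ZMod p) * X ^ 2 +
    C ((pellY r p : ZMod p) - (r : ZMod p) ^ (p / 3)) * X + C ((pellX r p : ZMod p) - 1)
  have hg : AdjoinRoot.mk f g = 0 := by
    simp only [g, map_add, map_mul, map_pow, map_sub, map_one, map_intCast, AdjoinRoot.mk_X]
    linear_combination hpow
  have hg₀ : g = 0 := by
    by_contra hne
    refine hf.not_dvd_of_degree_lt hne ?_ (AdjoinRoot.mk_eq_zero.mp hg)
    rw [degree_X_pow_sub_C (by norm_num)]
    exact degree_quadratic_lt
  rw [← ZMod.intCast_zmod_eq_zero_iff_dvd]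
  have hcoeff : g.coeff 2 = (pellZ r p : ZMod p) := by
    simp only [g, coeff_add, coeff_C_mul, coeff_X_pow, coeff_X, coeff_C]
    norm_num
  rw [← hcoeff, hg₀, coeff_zero]

theorem stmt_12 (p : ℕ) (hp : p.Prime) (hp3 : 3 < p) (hpmod : p % 3 = 1) (r : ℤ)
    (hr : ∀ b : ZMod p, b ^ 3 ≠ (r : ZMod p)) :
    ∃ m : ℕ, 0 < m ∧ m ≤ p ∧ (p : ℤ) ∣ pellZ r m :=
  ⟨p, hp.pos, le_rfl, prime_dvd_pellZ p hp hpmod r⟩
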